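/- Let d ≥ 1, let M be a Borel measure on ℝ^d, let λ, t > 0 and z ∈ ℝ^d, and suppose ∫_{\{x : 1 < |x| ≤ e^{λt}\}} |x| M(dx) < ∞. Then λ ∫_0^t ( ∫_{ℝ^d} ⟨z,x⟩ 1_{\{1 < |x| ≤ e^{λs}\}}(x) M(dx) ) e^{-λs} ds = ∫_{\{x : 1 < |x| ≤ e^{λt}\}} ⟨z,x⟩ (|x|^{-1} - e^{-λt}) M(dx). -/

import Mathlib

open MeasureTheory
open scoped RealInnerProductSpace

/-- The Fubini-type identity used for the drift term (case `α = 1`) in Theorem 1: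
`λ ∫_0^t (∫_{1<|x|≤e^{λs}} ⟨z,x⟩ M(dx)) e^{-λs} ds
  = ∫_{1<|x|≤e^{λt}} ⟨z,x⟩ (|x|⁻¹ - e^{-λt}) M(dx)`. -/
theorem stmt_19 (d : ℕ) (hd : 1 ≤ d) (M : Measure (EuclideanSpace ℝ (Fin d)))
    (lam t : ℝ) (hlam : 0 < lam) (ht : 0 < t) (z : EuclideanSpace ℝ (Fin d))
    (hint : (∫⁻ x in {x : EuclideanSpace ℝ (Fin d) | 1 < ‖x‖ ∧ ‖x‖ ≤ Real.exp (lam * t)},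
        ENNReal.ofReal ‖x‖ ∂M) < ⊤) :
    lam * ∫ s in (0 : ℝ)..t,
        (∫ x in {x : EuclideanSpace ℝ (Fin d) | 1 < ‖x‖ ∧ ‖x‖ ≤ Real.exp (lam * s)},
          ⟪z, x⟫ ∂M) * Real.exp (-(lam * s))
      = ∫ x in {x : EuclideanSpace ℝ (Fin d) | 1 < ‖x‖ ∧ ‖x‖ ≤ Real.exp (lam * t)},
          ⟪z, x⟫ * (‖x‖⁻¹ - Real.exp (-(lam * t))) ∂M := by
  classical
  set A : Set (EuclideanSpace ℝ (Fin d)) := {x : EuclideanSpace ℝ (Fin d) | 1 < ‖x‖ ∧ ‖x‖ ≤ Real.exp (lam * t)} with hA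
  have hAm : MeasurableSet A :=
    (measurableSet_lt measurable_const measurable_norm).inter
      (measurableSet_le measurable_norm measurable_const)
  have hnorm : Integrable (fun x : EuclideanSpace ℝ (Fin d) => ‖x‖) (M.restrict A) := by
    refine ⟨measurable_norm.aestronglyMeasurable, ?_⟩
    rw [hasFiniteIntegral_iff_ofReal (Filter.Eventually.of_forall fun x => norm_nonneg x)]
    exact hint
  have hfin : IsFiniteMeasure (M.restrict A) := by
    refine ⟨lt_of_le_of_lt ?_ hint⟩
    rw [← lintegral_one]
    refine setLIntegral_mono' hAm fun x hx => ?_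
    rw [← ENNReal.ofReal_one]
    exact ENNReal.ofReal_le_ofReal hx.1.le
  have hinner : Integrable (fun x : EuclideanSpace ℝ (Fin d) => ⟪z, x⟫) (M.restrict A) := by
    refine (hnorm.const_mul ‖z‖).mono' (by fun_prop) ?_
    exact Filter.Eventually.of_forall fun x => norm_inner_le_norm z x
  set B : Set (ℝ × EuclideanSpace ℝ (Fin d)) := {p | ‖p.2‖ ≤ Real.exp (lam * p.1)} with hB
  have hBm : MeasurableSet B := measurableSet_le (by fun_prop) (by fun_prop)
  set F : ℝ × EuclideanSpace ℝ (Fin d) → ℝ := B.indicator (fun p => ⟪z, p.2⟫ * Real.exp (-(lam * p.1))) with hF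
  have hFint : Integrable F ((volume.restrict (Set.Ioc 0 t)).prod (M.restrict A)) := by
    refine Integrable.indicator ?_ hBm
    have he : Integrable (fun s : ℝ => Real.exp (-(lam * s))) (volume.restrict (Set.Ioc 0 t)) := by
      have : Continuous (fun s : ℝ => Real.exp (-(lam * s))) := by fun_prop
      exact (this.integrableOn_Icc).mono_set Set.Ioc_subset_Icc_self
    exact (he.mul_prod hinner).congr (Filter.Eventually.of_forall fun p => mul_comm _ _)
  have h1 : ∫ s in (0 : ℝ)..t,
        (∫ x in {x : EuclideanSpace ℝ (Fin d) | 1 < ‖x‖ ∧ ‖x‖ ≤ Real.exp (lam * s)},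
          ⟪z, x⟫ ∂M) * Real.exp (-(lam * s))
      = ∫ s in Set.Ioc 0 t, ∫ x in A, F (s, x) ∂M := by
    rw [intervalIntegral.integral_of_le ht.le]
    refine setIntegral_congr_fun measurableSet_Ioc fun s hs => ?_
    have hCm : MeasurableSet {x : EuclideanSpace ℝ (Fin d) | ‖x‖ ≤ Real.exp (lam * s)} :=
      measurableSet_le measurable_norm measurable_const
    have e1 : (fun x : EuclideanSpace ℝ (Fin d) => F (s, x)) = {x : EuclideanSpace ℝ (Fin d) | ‖x‖ ≤ Real.exp (lam * s)}.indicator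
        (fun x => ⟪z, x⟫ * Real.exp (-(lam * s))) := by
      ext x
      simp only [hF, hB, Set.indicator_apply, Set.mem_ofPred_eq]
    have e2 : A ∩ {x : EuclideanSpace ℝ (Fin d) | ‖x‖ ≤ Real.exp (lam * s)}
        = {x : EuclideanSpace ℝ (Fin d) | 1 < ‖x‖ ∧ ‖x‖ ≤ Real.exp (lam * s)} := by
      ext x
      simp only [hA, Set.mem_inter_iff, Set.mem_ofPred_eq]
      constructor
      · rintro ⟨⟨a, b⟩, c⟩
        exact ⟨a, c⟩
      · rintro ⟨a, c⟩
        refine ⟨⟨a, c.trans (Real.exp_le_exp.2 ?_)⟩, c⟩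
        exact mul_le_mul_of_nonneg_left hs.2 hlam.le
    simp only [e1]
    rw [setIntegral_indicator hCm, e2, integral_mul_const]
  rw [h1, integral_integral_swap (f := fun s x => F (s, x)) hFint, ← integral_const_mul]
  refine setIntegral_congr_fun hAm fun x hx => ?_
  have hx0 : 0 < ‖x‖ := one_pos.trans hx.1
  set a := Real.log ‖x‖ / lam with ha
  have hla : lam * a = Real.log ‖x‖ := by rw [ha]; field_simp
  have ha0 : 0 < a := div_pos (Real.log_pos hx.1) hlam
  have hat : a ≤ t := by
    rw [ha, div_le_iff₀ hlam, Real.log_le_iff_le_exp hx0, mul_comm]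
    exact hx.2
  have e1 : (fun s : ℝ => F (s, x)) = (Set.Ici a).indicator
      (fun s => ⟪z, x⟫ * Real.exp (-(lam * s))) := by
    ext s
    have : ‖x‖ ≤ Real.exp (lam * s) ↔ a ≤ s := by
      rw [← Real.log_le_iff_le_exp hx0, ha, div_le_iff₀ hlam, mul_comm]
    simp only [hF, hB, Set.indicator_apply, Set.mem_ofPred_eq, Set.mem_Ici, this]
  have e2 : Set.Ioc 0 t ∩ Set.Ici a = Set.Icc a t := by
    ext s
    simp only [Set.mem_inter_iff, Set.mem_Ioc, Set.mem_Ici, Set.mem_Icc]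
    constructor
    · rintro ⟨⟨_, b⟩, c⟩
      exact ⟨c, b⟩
    · rintro ⟨c, b⟩
      exact ⟨⟨ha0.trans_le c, b⟩, c⟩
  have e3 : ∫ s in a..t, Real.exp (-(lam * s))
      = (‖x‖⁻¹ - Real.exp (-(lam * t))) / lam := by
    have hd : ∀ s ∈ Set.uIcc a t, HasDerivAt (fun s : ℝ => -Real.exp (-(lam * s)) / lam)
        (Real.exp (-(lam * s))) s := by
      intro s _
      have h0 : HasDerivAt (fun s : ℝ => -(lam * s)) (-(lam * 1)) s :=
        ((hasDerivAt_id s).const_mul lam).neg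
      have h : HasDerivAt (fun s : ℝ => -Real.exp (-(lam * s)) / lam)
          (-(Real.exp (-(lam * s)) * (-(lam * 1))) / lam) s := (h0.exp.neg).div_const lam
      have e : -(Real.exp (-(lam * s)) * (-(lam * 1))) / lam = Real.exp (-(lam * s)) := by
        field_simp
        try ring
      rwa [e] at h
    rw [intervalIntegral.integral_eq_sub_of_hasDerivAt hd
      (Continuous.intervalIntegrable (by fun_prop) _ _), hla, Real.exp_neg (Real.log _),
      Real.exp_log hx0]
    ring
  simp only [e1]
  rw [setIntegral_indicator measurableSet_Ici, e2, integral_Icc_eq_integral_Ioc,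
    ← intervalIntegral.integral_of_le hat, intervalIntegral.integral_const_mul, e3]
  field_simp
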